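/- Let s > 1/2 and T ∈ (0,1]. For smooth solutions v₁, v₂ ∈ C([−T,T]; H^∞(𝕋)) of the symmetrized renormalized fifth-order mKdV equation and for w = v₁ − v₂ ∈ E^s(T) ∩ C([−T,T]; H^∞(𝕋)), there exists δ, 0 < δ ≪ 1, such that if ‖v₁‖_{L^∞_T H^s(𝕋)} ≤ δ and ‖v₂‖_{L^∞_T H^s(𝕋)} ≤ δ, then (1/2)‖w‖²_{E^s(T)} ≤ E_T^s(w) ≤ (3/2)‖w‖²_{E^s(T)}. -/

import Mathlib

noncomputable section

open scoped BigOperators ComplexConjugate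
open MeasureTheory Complex Set

namespace MKdV5

/-! ### Sobolev data on the Fourier side.

A function `u ∈ H^s(𝕋)` (with `𝕋 = ℝ/2πℤ`) is represented by its sequence of Fourier
coefficients `a : ℤ → ℂ`, `a n = û(n) = (2π)^{-1/2}∫_𝕋 e^{-inx}u(x)dx`; real-valuedness of `u`
corresponds to `conj (a n) = a (-n)`. -/

/-- The weight `(1+n²)^s` of the `H^s(𝕋)` norm. -/
def hsWeight (s : ℝ) (n : ℤ) : ℝ := (1 + (n : ℝ) ^ 2) ^ s

/-- `a` is (the sequence of Fourier coefficients of) an element of `H^s(𝕋)`. -/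
def InHs (s : ℝ) (a : ℤ → ℂ) : Prop := Summable fun n : ℤ => hsWeight s n * ‖a n‖ ^ 2

/-- The square of the `H^s(𝕋)` norm. -/
def hsNormSq (s : ℝ) (a : ℤ → ℂ) : ℝ := ∑' n : ℤ, hsWeight s n * ‖a n‖ ^ 2

/-- The `H^s(𝕋)` norm. -/
def hsNorm (s : ℝ) (a : ℤ → ℂ) : ℝ := Real.sqrt (hsNormSq s a)

/-- The Fourier coefficients of a real-valued function satisfy `conj (a n) = a (-n)`. -/
def IsRealCoeff (a : ℤ → ℂ) : Prop := ∀ n : ℤ, conj (a n) = a (-n)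

/-- `u ∈ C([-T,T]; H^s(𝕋))`, on the Fourier side. -/
def ContHs (s T : ℝ) (u : ℝ → ℤ → ℂ) : Prop :=
  (∀ t ∈ Icc (-T) T, InHs s (u t)) ∧
    ∀ t ∈ Icc (-T) T, ∀ ε > 0, ∃ δ > 0, ∀ t' ∈ Icc (-T) T,
      |t' - t| < δ → hsNorm s (fun n => u t' n - u t n) < ε

/-- `u ∈ C([-T,T]; H^∞(𝕋))`. -/
def ContHinf (T : ℝ) (u : ℝ → ℤ → ℂ) : Prop := ∀ s : ℝ, ContHs s T u

/-- The nonresonance condition defining `𝒩_{3,n}`. -/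
abbrev N3cond (n₁ n₂ n₃ : ℤ) : Prop := (n₁ + n₂) * (n₁ + n₃) * (n₂ + n₃) ≠ 0

/-- The nonresonance condition defining `𝒩_{5,n}`: no four of the five frequencies sum to zero. -/
abbrev N5cond (n₁ n₂ n₃ n₄ n₅ : ℤ) : Prop :=
  n₁ + n₂ + n₃ + n₄ ≠ 0 ∧ n₁ + n₂ + n₃ + n₅ ≠ 0 ∧ n₁ + n₂ + n₄ + n₅ ≠ 0 ∧
    n₁ + n₃ + n₄ + n₅ ≠ 0 ∧ n₂ + n₃ + n₄ + n₅ ≠ 0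

/-- Sum over `(n₁,n₂,n₃) ∈ 𝒩_{3,n}` of `K(n₁,n₂,n₃)·a(n₁)b(n₂)c(n₃)`. -/
def cubicN3Sum (K : ℤ → ℤ → ℤ → ℂ) (a b c : ℤ → ℂ) (n : ℤ) : ℂ :=
  ∑' p : ℤ × ℤ, if N3cond p.1 p.2 (n - p.1 - p.2) then
    K p.1 p.2 (n - p.1 - p.2) * a p.1 * b p.2 * c (n - p.1 - p.2) else 0

/-- Sum over `(n₁,…,n₅) ∈ 𝒩_{5,n}` of `a₁(n₁)⋯a₅(n₅)`. -/
def quinticN5Sum (a₁ a₂ a₃ a₄ a₅ : ℤ → ℂ) (n : ℤ) : ℂ :=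
  ∑' q : ℤ × ℤ × ℤ × ℤ,
    if N5cond q.1 q.2.1 q.2.2.1 q.2.2.2 (n - q.1 - q.2.1 - q.2.2.1 - q.2.2.2) then
      a₁ q.1 * a₂ q.2.1 * a₃ q.2.2.1 * a₄ q.2.2.2 * a₅ (n - q.1 - q.2.1 - q.2.2.1 - q.2.2.2)
    else 0

/-- The dispersion relation `μ(n) = n⁵ + d₁n³ + d₂n`. -/
def muPhase (d₁ d₂ : ℝ) (n : ℤ) : ℝ := (n : ℝ) ^ 5 + d₁ * (n : ℝ) ^ 3 + d₂ * (n : ℝ)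

end MKdV5

namespace MKdV5

/-! ### Short-time function spaces `X_k`, `F_k`, `N_k`, `F^s(T)`, `N^s(T)`, `E^s(T)`. -/

/-- A smooth bump function `η₀ : ℝ → [0,1]` supported in `[-2,2]`, equal to `1` on `[-1,1]`. -/
structure BumpFun (η₀ : ℝ → ℝ) : Prop where
  smooth : ContDiff ℝ (⊤ : ℕ∞) η₀
  mem : ∀ x, η₀ x ∈ Icc (0 : ℝ) 1
  supp : ∀ x, 2 < |x| → η₀ x = 0
  eq_one : ∀ x ∈ Icc (-1 : ℝ) 1, η₀ x = 1

/-- The dyadic cutoffs `χ₀ = η₀`, `χ_k(ξ) = η₀(ξ/2^k) - η₀(ξ/2^{k-1})` for `k ≥ 1`. -/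
def chi (η₀ : ℝ → ℝ) : ℕ → ℝ → ℝ
  | 0 => η₀
  | k + 1 => fun ξ => η₀ (ξ / 2 ^ (k + 1)) - η₀ (ξ / 2 ^ k)

/-- `η_{≤l} = Σ_{j≤l} χ_j` (in the modulation variable). -/
def chiLe (η₀ : ℝ → ℝ) (l : ℕ) (x : ℝ) : ℝ := ∑ j ∈ Finset.range (l + 1), chi η₀ j x

/-- `χ_k` read on the integers. -/
def chiZ (η₀ : ℝ → ℝ) (k : ℕ) (n : ℤ) : ℝ := chi η₀ k (n : ℝ)

/-- `ψ_k(n) = n·χ_k'(n)`. -/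
def psiZ (η₀ : ℝ → ℝ) (k : ℕ) (n : ℤ) : ℝ := (n : ℝ) * deriv (chi η₀ k) (n : ℝ)

/-- The modulation weight `β_{j,k}`: `β_{j,0} = 1`, `β_{j,k} = 1 + 2^{(j-5k)/4}` for `k ≥ 1`. -/
def betaWt (j k : ℕ) : ℝ := if k = 0 then 1 else 1 + (2 : ℝ) ^ (((j : ℝ) - 5 * (k : ℝ)) / 4)

/-- The `L²_τ ℓ²_n` norm. -/
def l2l2 (f : ℝ → ℤ → ℂ) : ℝ := Real.sqrt (∫ τ : ℝ, ∑' n : ℤ, ‖f τ n‖ ^ 2)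

/-- The `X_k = X^{0,1/2,1}`-type norm with weights `β_{j,k}`. -/
def Xnorm (η₀ : ℝ → ℝ) (d₁ d₂ : ℝ) (k : ℕ) (f : ℝ → ℤ → ℂ) : ℝ :=
  ∑' j : ℕ, (2 : ℝ) ^ ((j : ℝ) / 2) * betaWt j k *
    l2l2 fun τ n => ((chi η₀ j (τ - muPhase d₁ d₂ n) : ℝ) : ℂ) * f τ n

/-- Finiteness of the `X_k` norm: measurability, square-integrability of each dyadic
modulation piece, and summability of the defining series. -/
def XFinite (η₀ : ℝ → ℝ) (d₁ d₂ : ℝ) (k : ℕ) (f : ℝ → ℤ → ℂ) : Prop :=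
  Measurable (Function.uncurry f) ∧
  (∀ j : ℕ, Integrable (fun τ : ℝ =>
      ∑' n : ℤ, ‖((chi η₀ j (τ - muPhase d₁ d₂ n) : ℝ) : ℂ) * f τ n‖ ^ 2)) ∧
  Summable (fun j : ℕ => (2 : ℝ) ^ ((j : ℝ) / 2) * betaWt j k *
    l2l2 fun τ n => ((chi η₀ j (τ - muPhase d₁ d₂ n) : ℝ) : ℂ) * f τ n)

/-- The Fourier transform in time. -/
def timeFT (u : ℝ → ℤ → ℂ) : ℝ → ℤ → ℂ := fun τ n =>
  ((Real.sqrt (2 * Real.pi) : ℝ) : ℂ)⁻¹ * ∫ t : ℝ, Complex.exp (-(I * (τ : ℂ) * (t : ℂ))) * u t n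

/-- The inverse Fourier transform in time. -/
def timeIFT (f : ℝ → ℤ → ℂ) : ℝ → ℤ → ℂ := fun t n =>
  ((Real.sqrt (2 * Real.pi) : ℝ) : ℂ)⁻¹ * ∫ τ : ℝ, Complex.exp (I * (τ : ℂ) * (t : ℂ)) * f τ n

/-- Localization of `u` to time scale `2^{-2k}` around `t_k`. -/
def timeLoc (η₀ : ℝ → ℝ) (k : ℕ) (tk : ℝ) (u : ℝ → ℤ → ℂ) : ℝ → ℤ → ℂ := fun t n =>
  ((η₀ ((2 : ℝ) ^ (2 * k) * (t - tk)) : ℝ) : ℂ) * u t n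

/-- The `F_k` norm: `sup_{t_k} ‖ℱ[u·η₀(2^{2k}(t-t_k))]‖_{X_k}`. -/
def FkNorm (η₀ : ℝ → ℝ) (d₁ d₂ : ℝ) (k : ℕ) (u : ℝ → ℤ → ℂ) : ℝ :=
  ⨆ tk : ℝ, Xnorm η₀ d₁ d₂ k (timeFT (timeLoc η₀ k tk u))

/-- Finiteness of the `F_k` norm. -/
def FkFinite (η₀ : ℝ → ℝ) (d₁ d₂ : ℝ) (k : ℕ) (u : ℝ → ℤ → ℂ) : Prop :=
  BddAbove (Set.range fun tk : ℝ => Xnorm η₀ d₁ d₂ k (timeFT (timeLoc η₀ k tk u)))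

/-- The `N_k` norm: `sup_{t_k} ‖(τ-μ(n)+i2^{2k})⁻¹ℱ[u·η₀(2^{2k}(t-t_k))]‖_{X_k}`. -/
def NkNorm (η₀ : ℝ → ℝ) (d₁ d₂ : ℝ) (k : ℕ) (u : ℝ → ℤ → ℂ) : ℝ :=
  ⨆ tk : ℝ, Xnorm η₀ d₁ d₂ k fun τ n =>
    ((τ : ℂ) - ((muPhase d₁ d₂ n : ℝ) : ℂ) + I * (((2 : ℝ) ^ (2 * k) : ℝ) : ℂ))⁻¹ *
      timeFT (timeLoc η₀ k tk u) τ n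

/-- The time-restricted norm `F_k(T)` (infimum over extensions from `[-T,T]`). -/
def FkTNorm (η₀ : ℝ → ℝ) (d₁ d₂ : ℝ) (k : ℕ) (T : ℝ) (u : ℝ → ℤ → ℂ) : ℝ :=
  sInf (FkNorm η₀ d₁ d₂ k '' {w | ∀ t ∈ Icc (-T) T, w t = u t})

/-- The time-restricted norm `N_k(T)` (infimum over extensions from `[-T,T]`). -/
def NkTNorm (η₀ : ℝ → ℝ) (d₁ d₂ : ℝ) (k : ℕ) (T : ℝ) (u : ℝ → ℤ → ℂ) : ℝ :=
  sInf (NkNorm η₀ d₁ d₂ k '' {w | ∀ t ∈ Icc (-T) T, w t = u t})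

/-- The Littlewood-Paley projection `P_k`. -/
def Pk (η₀ : ℝ → ℝ) (k : ℕ) (u : ℝ → ℤ → ℂ) : ℝ → ℤ → ℂ := fun t n =>
  ((chiZ η₀ k n : ℝ) : ℂ) * u t n

/-- `‖u‖²_{F^s(T)} = Σ_k 2^{2sk}‖P_k u‖²_{F_k(T)}`. -/
def FsTNormSq (η₀ : ℝ → ℝ) (d₁ d₂ s T : ℝ) (u : ℝ → ℤ → ℂ) : ℝ :=
  ∑' k : ℕ, (2 : ℝ) ^ (2 * s * (k : ℝ)) * (FkTNorm η₀ d₁ d₂ k T (Pk η₀ k u)) ^ 2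

/-- The `F^s(T)` norm. -/
def FsTNorm (η₀ : ℝ → ℝ) (d₁ d₂ s T : ℝ) (u : ℝ → ℤ → ℂ) : ℝ :=
  Real.sqrt (FsTNormSq η₀ d₁ d₂ s T u)

/-- Membership in `F^s(T)` (finiteness of the norm). -/
def MemFsT (η₀ : ℝ → ℝ) (d₁ d₂ s T : ℝ) (u : ℝ → ℤ → ℂ) : Prop :=
  Summable fun k : ℕ => (2 : ℝ) ^ (2 * s * (k : ℝ)) * (FkTNorm η₀ d₁ d₂ k T (Pk η₀ k u)) ^ 2

/-- `‖u‖²_{N^s(T)} = Σ_k 2^{2sk}‖P_k u‖²_{N_k(T)}`. -/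
def NsTNormSq (η₀ : ℝ → ℝ) (d₁ d₂ s T : ℝ) (u : ℝ → ℤ → ℂ) : ℝ :=
  ∑' k : ℕ, (2 : ℝ) ^ (2 * s * (k : ℝ)) * (NkTNorm η₀ d₁ d₂ k T (Pk η₀ k u)) ^ 2

/-- The `N^s(T)` norm. -/
def NsTNorm (η₀ : ℝ → ℝ) (d₁ d₂ s T : ℝ) (u : ℝ → ℤ → ℂ) : ℝ :=
  Real.sqrt (NsTNormSq η₀ d₁ d₂ s T u)

/-- `‖u‖²_{E^s(T)} = ‖P₀u(0)‖²_{L²} + Σ_{k≥1} sup_{t_k∈[-T,T]} 2^{2sk}‖P_k u(t_k)‖²_{L²}`. -/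
def EsTNormSq (η₀ : ℝ → ℝ) (s T : ℝ) (u : ℝ → ℤ → ℂ) : ℝ :=
  (∑' n : ℤ, ‖((chiZ η₀ 0 n : ℝ) : ℂ) * u 0 n‖ ^ 2) +
    ∑' k : ℕ, sSup ((fun t : ℝ => (2 : ℝ) ^ (2 * s * ((k : ℝ) + 1)) *
      ∑' n : ℤ, ‖((chiZ η₀ (k + 1) n : ℝ) : ℂ) * u t n‖ ^ 2) '' Icc (-T) T)

/-- The `E^s(T)` norm. -/
def EsTNorm (η₀ : ℝ → ℝ) (s T : ℝ) (u : ℝ → ℤ → ℂ) : ℝ :=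
  Real.sqrt (EsTNormSq η₀ s T u)

end MKdV5
namespace MKdV5

/-- Membership in `F_k(T)`: some extension from `[-T,T]` has finite `F_k` norm. -/
def FkTFinite (η₀ : ℝ → ℝ) (d₁ d₂ : ℝ) (k : ℕ) (T : ℝ) (u : ℝ → ℤ → ℂ) : Prop :=
  ∃ w : ℝ → ℤ → ℂ, (∀ t ∈ Icc (-T) T, w t = u t) ∧ FkFinite η₀ d₁ d₂ k w

end MKdV5

namespace MKdV5

/-! ### The renormalized and symmetrized fifth-order mKdV equations, and their
nonlinear operators. -/

/-- The right-hand side of the renormalized fifth-order mKdV equation (5mkdv3). -/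
def renormRHS (a : ℤ → ℂ) (n : ℤ) : ℂ :=
  -20 * I * (n : ℂ) ^ 3 * (conj (a n) * a n * a n) +
    10 * I * (n : ℂ) * cubicN3Sum (fun _ _ n₃ => (n₃ : ℂ) ^ 2) a a a n +
    10 * I * (n : ℂ) * cubicN3Sum (fun _ n₂ n₃ => (n₂ : ℂ) * (n₃ : ℂ)) a a a n +
    6 * I * (n : ℂ) * quinticN5Sum a a a a a n

/-- The right-hand side of the symmetrized renormalized fifth-order mKdV equation (5mkdv4). -/
def symRHS (a : ℤ → ℂ) (n : ℤ) : ℂ :=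
  -20 * I * (n : ℂ) ^ 3 * (conj (a n) * a n * a n) +
    10 * I * (n : ℂ) * cubicN3Sum (fun _ _ n₃ => (n₃ : ℂ) ^ 2) a a a n +
    5 * I * (n : ℂ) * cubicN3Sum (fun n₁ n₂ n₃ => ((n₁ : ℂ) + (n₂ : ℂ)) * (n₃ : ℂ)) a a a n +
    6 * I * (n : ℂ) * quinticN5Sum a a a a a n

/-- `v` is a solution of the renormalized fifth-order mKdV equation on `[-T,T]` with datum `v₀`
(Duhamel formulation). -/
def IsRenormSolution (d₁ d₂ s T : ℝ) (v₀ : ℤ → ℂ) (v : ℝ → ℤ → ℂ) : Prop :=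
  ContHs s T v ∧ (∀ n : ℤ, v 0 n = v₀ n) ∧
    ∀ t ∈ Icc (-T) T, ∀ n : ℤ,
      v t n = Complex.exp (I * ((muPhase d₁ d₂ n : ℝ) : ℂ) * (t : ℂ)) * v₀ n +
        ∫ τ in (0:ℝ)..t,
          Complex.exp (I * ((muPhase d₁ d₂ n : ℝ) : ℂ) * ((t - τ : ℝ) : ℂ)) * renormRHS (v τ) n

/-- `v` is a (smooth, classical) solution of the symmetrized renormalized fifth-order mKdV
equation: `∂ₜv̂(n) - iμ(n)v̂(n) = symRHS(v)(n)` on `[-T,T]`. -/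
def IsSymSolution (d₁ d₂ T : ℝ) (v : ℝ → ℤ → ℂ) : Prop :=
  ∀ t ∈ Icc (-T) T, ∀ n : ℤ,
    HasDerivAt (fun t' => v t' n)
      (I * ((muPhase d₁ d₂ n : ℝ) : ℂ) * v t n + symRHS (v t) n) t

/-- `N₁(u,v,w)^(n) = -20in³ û(n)v̂(-n)ŵ(n)` (polarization of `-20in³|v̂(n)|²v̂(n)`). -/
def N1op (u v w : ℝ → ℤ → ℂ) : ℝ → ℤ → ℂ := fun t n =>
  -20 * I * (n : ℂ) ^ 3 * u t n * v t (-n) * w t n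

/-- `N₂(u,v,w)^(n) = 10in Σ_{𝒩_{3,n}} û(n₁)v̂(n₂)n₃²ŵ(n₃)`. -/
def N2op (u v w : ℝ → ℤ → ℂ) : ℝ → ℤ → ℂ := fun t n =>
  10 * I * (n : ℂ) * cubicN3Sum (fun _ _ n₃ => (n₃ : ℂ) ^ 2) (u t) (v t) (w t) n

/-- `N₃(u,v,w)^(n) = 10in Σ_{𝒩_{3,n}} û(n₁)n₂v̂(n₂)n₃ŵ(n₃)`. -/
def N3op (u v w : ℝ → ℤ → ℂ) : ℝ → ℤ → ℂ := fun t n =>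
  10 * I * (n : ℂ) * cubicN3Sum (fun _ n₂ n₃ => (n₂ : ℂ) * (n₃ : ℂ)) (u t) (v t) (w t) n

/-- `N₄(v₁,…,v₅)^(n) = 6in Σ_{𝒩_{5,n}} v̂₁(n₁)⋯v̂₅(n₅)`. -/
def N4op (v₁ v₂ v₃ v₄ v₅ : ℝ → ℤ → ℂ) : ℝ → ℤ → ℂ := fun t n =>
  6 * I * (n : ℂ) * quinticN5Sum (v₁ t) (v₂ t) (v₃ t) (v₄ t) (v₅ t) n

end MKdV5

namespace MKdV5

/-! ### Modified energies. -/

/-- The quadrilinear correction term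
`Re Σ_{n, n₁+n₂+n₃+n=0, nonresonant} a(n₁)b(n₂)g(n₃)(1/n₃)w(n₃)χ_k(n)(1/n)w(n)`. -/
def quadEnergyTerm (η₀ : ℝ → ℝ) (k : ℕ) (g : ℤ → ℝ) (a b w : ℤ → ℂ) : ℝ :=
  (∑' p : ℤ × ℤ × ℤ,
    if N3cond p.1 p.2.1 p.2.2 then
      a p.1 * b p.2.1 * ((g p.2.2 : ℝ) : ℂ) * ((p.2.2 : ℤ) : ℂ)⁻¹ * w p.2.2 *
        ((chiZ η₀ k (-(p.1 + p.2.1 + p.2.2)) : ℝ) : ℂ) *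
        (((-(p.1 + p.2.1 + p.2.2) : ℤ) : ℂ))⁻¹ * w (-(p.1 + p.2.1 + p.2.2))
    else 0).re

/-- The localized modified energy `E_k(w)(t)` (with `κ = -4/3`, `ε = -2/3`). -/
def modEnergyK (η₀ : ℝ → ℝ) (k : ℕ) (v₁ v₂ w : ℝ → ℤ → ℂ) (t : ℝ) : ℝ :=
  (∑' n : ℤ, ‖((chiZ η₀ k n : ℝ) : ℂ) * w t n‖ ^ 2) -
    (4 / 3) * (quadEnergyTerm η₀ k (psiZ η₀ k) (v₁ t) (v₁ t) (w t) +
      quadEnergyTerm η₀ k (psiZ η₀ k) (v₁ t) (v₂ t) (w t) +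
      quadEnergyTerm η₀ k (psiZ η₀ k) (v₂ t) (v₂ t) (w t)) -
    (2 / 3) * (quadEnergyTerm η₀ k (chiZ η₀ k) (v₁ t) (v₁ t) (w t) +
      quadEnergyTerm η₀ k (chiZ η₀ k) (v₁ t) (v₂ t) (w t) +
      quadEnergyTerm η₀ k (chiZ η₀ k) (v₂ t) (v₂ t) (w t))

/-- The modified energy `E_T^s(w) = ‖P₀w(0)‖² + Σ_{k≥1} 2^{2sk} sup_{t∈[-T,T]} E_k(w)(t)`. -/
def modEnergyT (η₀ : ℝ → ℝ) (s T : ℝ) (v₁ v₂ w : ℝ → ℤ → ℂ) : ℝ :=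
  (∑' n : ℤ, ‖((chiZ η₀ 0 n : ℝ) : ℂ) * w 0 n‖ ^ 2) +
    ∑' k : ℕ, (2 : ℝ) ^ (2 * s * ((k : ℝ) + 1)) *
      sSup (modEnergyK η₀ (k + 1) v₁ v₂ w '' Icc (-T) T)

end MKdV5

namespace MKdV5

/-! ### Sobolev norms on the Fourier side -/

lemma hsWeight_pos (s : ℝ) (n : ℤ) : 0 < hsWeight s n :=
  Real.rpow_pos_of_pos (by positivity) s

lemma one_le_hsWeight {s : ℝ} (hs : 0 ≤ s) (n : ℤ) : 1 ≤ hsWeight s n :=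
  Real.one_le_rpow (by nlinarith [sq_nonneg (n : ℝ)]) hs

lemma hsNormSq_nonneg (s : ℝ) (a : ℤ → ℂ) : 0 ≤ hsNormSq s a :=
  tsum_nonneg fun n => mul_nonneg (hsWeight_pos s n).le (sq_nonneg _)

lemma norm_sub_sq_le (x y : ℂ) : ‖x - y‖ ^ 2 ≤ 2 * ‖x‖ ^ 2 + 2 * ‖y‖ ^ 2 := by
  have h := norm_sub_le x y
  nlinarith [norm_nonneg (x - y), sq_nonneg (‖x‖ - ‖y‖)]

lemma hsWeight_mul_norm_sub_sq_le (s : ℝ) (a b : ℤ → ℂ) (n : ℤ) :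
    hsWeight s n * ‖a n - b n‖ ^ 2 ≤
      2 * (hsWeight s n * ‖a n‖ ^ 2) + 2 * (hsWeight s n * ‖b n‖ ^ 2) := by
  nlinarith [mul_le_mul_of_nonneg_left (norm_sub_sq_le (a n) (b n)) (hsWeight_pos s n).le]

lemma InHs.sub {s : ℝ} {a b : ℤ → ℂ} (ha : InHs s a) (hb : InHs s b) :
    InHs s fun n => a n - b n :=
  Summable.of_nonneg_of_le (fun n => mul_nonneg (hsWeight_pos s n).le (sq_nonneg _))
    (hsWeight_mul_norm_sub_sq_le s a b) ((ha.mul_left 2).add (hb.mul_left 2))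

lemma hsNormSq_sub_le {s : ℝ} {a b : ℤ → ℂ} (ha : InHs s a) (hb : InHs s b) :
    hsNormSq s (fun n => a n - b n) ≤ 2 * hsNormSq s a + 2 * hsNormSq s b := by
  have h := (ha.sub hb).tsum_le_tsum (hsWeight_mul_norm_sub_sq_le s a b)
    ((ha.mul_left 2).add (hb.mul_left 2))
  rwa [(ha.mul_left 2).tsum_add (hb.mul_left 2), tsum_mul_left, tsum_mul_left] at h

/-- A continuous curve in `H^s` on a compact time interval is bounded. -/
lemma ContHs.exists_bound {s T : ℝ} {u : ℝ → ℤ → ℂ} (hu : ContHs s T u) :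
    ∃ R, ∀ t ∈ Icc (-T) T, hsNormSq s (u t) ≤ R := by
  refine isCompact_Icc.induction_on (p := fun S => ∃ R, ∀ t ∈ S, hsNormSq s (u t) ≤ R)
    ⟨0, by simp⟩ (fun S S' hS ⟨R, hR⟩ => ⟨R, fun t ht => hR t (hS ht)⟩) ?_ ?_
  · rintro S S' ⟨R, hR⟩ ⟨R', hR'⟩
    exact ⟨max R R', fun t ht => ht.elim (fun h => (hR t h).trans (le_max_left _ _))
      fun h => (hR' t h).trans (le_max_right _ _)⟩
  · intro t ht
    obtain ⟨δ, hδ, h⟩ := hu.2 t ht 1 one_pos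
    refine ⟨Icc (-T) T ∩ Metric.ball t δ,
      inter_mem_nhdsWithin _ (Metric.ball_mem_nhds t hδ), 2 + 2 * hsNormSq s (u t), ?_⟩
    rintro t' ⟨ht', hd⟩
    have h1 := h t' ht' (by simpa [Real.dist_eq] using hd)
    have hdiff := (hu.1 t' ht').sub (hu.1 t ht)
    have h2 : hsNormSq s (fun n => u t' n - u t n) ≤ 1 := by
      have := (Real.sqrt_lt' one_pos).1 h1
      nlinarith
    have hneg : InHs s fun n => -u t n := by simpa [InHs] using hu.1 t ht
    have h3 := hsNormSq_sub_le hdiff hneg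
    have h4 : hsNormSq s (fun n => -u t n) = hsNormSq s (u t) := by simp [hsNormSq]
    simp only [sub_neg_eq_add, sub_add_cancel] at h3
    rw [h4] at h3
    linarith

lemma summable_hsWeight_inv {s : ℝ} (hs : 1 / 2 < s) :
    Summable fun n : ℤ => (hsWeight s n)⁻¹ := by
  have hp : Summable fun n : ℤ => |(n : ℝ)| ^ (-(2 * s)) :=
    Real.summable_abs_int_rpow (by linarith)
  refine (hp.add (summable_of_ne_finset_zero (s := {(0 : ℤ)})
    (f := fun n : ℤ => if n = 0 then (1 : ℝ) else 0) (by simp))).of_nonneg_of_le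
    (fun n => (inv_pos.2 (hsWeight_pos s n)).le) fun n => ?_
  rcases eq_or_ne n 0 with rfl | hn
  · have : (0 : ℝ) ≤ |((0 : ℤ) : ℝ)| ^ (-(2 * s)) := by positivity
    simp only [if_true]
    have h1 : hsWeight s 0 = 1 := by simp [hsWeight]
    rw [h1, inv_one]; linarith
  · have hn' : 0 < |(n : ℝ)| := by positivity
    simp only [hn, if_false, add_zero]
    rw [Real.rpow_neg hn'.le]
    refine inv_anti₀ (by positivity) ?_
    rw [Real.rpow_mul hn'.le]
    refine Real.rpow_le_rpow (by positivity) ?_ (by linarith)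
    norm_num

/-- The embedding `H^s ⊂ ℱℓ¹` for `s > 1/2`. -/
lemma InHs.summable_norm {s : ℝ} (hs : 1 / 2 < s) {a : ℤ → ℂ} (ha : InHs s a) :
    Summable (fun n => ‖a n‖) ∧
      ∑' n, ‖a n‖ ≤ Real.sqrt (∑' n : ℤ, (hsWeight s n)⁻¹) * hsNorm s a := by
  have key := Real.summable_and_inner_le_Lp_mul_Lq_tsum_of_nonneg (p := 2) (q := 2)
    (f := fun n : ℤ => Real.sqrt (hsWeight s n)⁻¹)
    (g := fun n : ℤ => Real.sqrt (hsWeight s n) * ‖a n‖)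
    (by constructor <;> norm_num) (fun n => Real.sqrt_nonneg _) (fun n => by positivity)
  have e1 : ∀ n : ℤ, Real.sqrt (hsWeight s n)⁻¹ ^ (2 : ℝ) = (hsWeight s n)⁻¹ := fun n => by
    rw [Real.rpow_two, Real.sq_sqrt (inv_pos.2 (hsWeight_pos s n)).le]
  have e2 : ∀ n : ℤ, (Real.sqrt (hsWeight s n) * ‖a n‖) ^ (2 : ℝ) =
      hsWeight s n * ‖a n‖ ^ 2 := fun n => by
    rw [Real.rpow_two, mul_pow, Real.sq_sqrt (hsWeight_pos s n).le]
  have e3 : ∀ n : ℤ, Real.sqrt (hsWeight s n)⁻¹ * (Real.sqrt (hsWeight s n) * ‖a n‖) =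
      ‖a n‖ := fun n => by
    rw [← mul_assoc, Real.sqrt_inv,
      inv_mul_cancel₀ (Real.sqrt_pos.2 (hsWeight_pos s n)).ne', one_mul]
  simp only [e1, e2, e3] at key
  have := key (summable_hsWeight_inv hs) ha
  simpa only [hsNorm, hsNormSq, Real.sqrt_eq_rpow] using this

/-! ### The dyadic cutoffs -/

lemma BumpFun.eq_zero {η₀ : ℝ → ℝ} (hη : BumpFun η₀) {x : ℝ} (hx : 2 ≤ |x|) : η₀ x = 0 := by
  have hcl : IsClosed {y | η₀ y = 0} := isClosed_eq hη.smooth.continuous continuous_const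
  rcases le_abs.1 hx with h | h
  · have : x ∈ closure (Ioi x) := by simp
    exact hcl.closure_subset_iff.2
      (fun y hy => hη.supp y (lt_of_lt_of_le (lt_of_le_of_lt h hy) (le_abs_self y))) this
  · have : x ∈ closure (Iio x) := by simp
    refine hcl.closure_subset_iff.2 (fun y hy => hη.supp y ?_) this
    have hy' : y < x := hy
    exact lt_of_lt_of_le (by linarith) (neg_le_abs y)

lemma BumpFun.eq_one' {η₀ : ℝ → ℝ} (hη : BumpFun η₀) {x : ℝ} (hx : |x| ≤ 1) : η₀ x = 1 :=
  hη.eq_one x (abs_le.1 hx)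

lemma BumpFun.deriv_eq_zero {η₀ : ℝ → ℝ} (hη : BumpFun η₀) {x : ℝ}
    (hx : |x| ≤ 1 ∨ 2 ≤ |x|) : deriv η₀ x = 0 := by
  rcases hx with hx | hx
  · exact IsLocalMax.deriv_eq_zero
      (Filter.Eventually.of_forall fun y => by rw [hη.eq_one' hx]; exact (hη.mem y).2)
  · exact IsLocalMin.deriv_eq_zero
      (Filter.Eventually.of_forall fun y => by rw [hη.eq_zero hx]; exact (hη.mem y).1)

lemma BumpFun.exists_abs_mul_deriv_le {η₀ : ℝ → ℝ} (hη : BumpFun η₀) :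
    ∃ M, 0 ≤ M ∧ ∀ x, |x * deriv η₀ x| ≤ M := by
  have hc : Continuous fun x => x * deriv η₀ x :=
    continuous_id.mul (hη.smooth.continuous_deriv (by simp))
  obtain ⟨M, hM⟩ := (isCompact_Icc (a := (-2 : ℝ)) (b := 2)).exists_bound_of_continuousOn
    hc.continuousOn
  refine ⟨max M 0, le_max_right _ _, fun x => ?_⟩
  rcases le_total |x| 2 with h | h
  · exact (hM x (abs_le.1 h)).trans (le_max_left _ _)
  · rw [hη.deriv_eq_zero (Or.inr h)]; simp

lemma psiZ_succ {η₀ : ℝ → ℝ} (hη : BumpFun η₀) (k : ℕ) (n : ℤ) :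
    psiZ η₀ (k + 1) n = (n : ℝ) / 2 ^ (k + 1) * deriv η₀ ((n : ℝ) / 2 ^ (k + 1)) -
      (n : ℝ) / 2 ^ k * deriv η₀ ((n : ℝ) / 2 ^ k) := by
  have hd : Differentiable ℝ η₀ := hη.smooth.differentiable (by simp)
  have h : ∀ j : ℕ, HasDerivAt (fun ξ : ℝ => η₀ (ξ / 2 ^ j))
      (deriv η₀ ((n : ℝ) / 2 ^ j) * (1 / 2 ^ j)) (n : ℝ) := fun j =>
    (hd _).hasDerivAt.comp (n : ℝ) ((hasDerivAt_id (n : ℝ)).div_const _)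
  have h2 : deriv (chi η₀ (k + 1)) (n : ℝ) = _ := ((h (k + 1)).sub (h k)).deriv
  rw [psiZ, h2]
  ring

lemma chiZ_succ (η₀ : ℝ → ℝ) (k : ℕ) (n : ℤ) :
    chiZ η₀ (k + 1) n = η₀ ((n : ℝ) / 2 ^ (k + 1)) - η₀ ((n : ℝ) / 2 ^ k) := rfl

lemma abs_chiZ_succ_le {η₀ : ℝ → ℝ} (hη : BumpFun η₀) (k : ℕ) (n : ℤ) :
    |chiZ η₀ (k + 1) n| ≤ 1 := by
  have h1 := hη.mem ((n : ℝ) / 2 ^ (k + 1))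
  have h2 := hη.mem ((n : ℝ) / 2 ^ k)
  rw [chiZ_succ, abs_le]
  constructor <;> linarith [h1.1, h1.2, h2.1, h2.2]

lemma abs_div_two_pow (x : ℝ) (k : ℕ) : |x / 2 ^ k| = |x| / 2 ^ k := by
  rw [abs_div, abs_of_pos (by positivity : (0 : ℝ) < 2 ^ k)]

lemma chiZ_succ_eq_zero {η₀ : ℝ → ℝ} (hη : BumpFun η₀) {k : ℕ} {n : ℤ}
    (h : |(n : ℝ)| ≤ 2 ^ k) : chiZ η₀ (k + 1) n = 0 := by
  have hp : (0 : ℝ) < 2 ^ k := by positivity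
  rw [chiZ_succ, hη.eq_one', hη.eq_one', sub_self]
  · rw [abs_div_two_pow, div_le_one hp]; exact h
  · rw [abs_div_two_pow, div_le_one (by positivity), pow_succ]; linarith

/-- The term preceding the `k`-th one in a sequence, with the convention that it vanishes at
`k = 0`. -/
def prevTerm (u : ℕ → ℝ) : ℕ → ℝ
  | 0 => 0
  | k + 1 => u k

lemma sum_chiZ_eq_one {η₀ : ℝ → ℝ} (hη : BumpFun η₀) {k : ℕ} {n : ℤ}
    (h₁ : (2 : ℝ) ^ k < |(n : ℝ)|) (h₂ : |(n : ℝ)| ≤ 2 ^ (k + 2)) :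
    prevTerm (fun j => chiZ η₀ (j + 1) n) k + chiZ η₀ (k + 1) n + chiZ η₀ (k + 2) n = 1 := by
  have h1 : η₀ ((n : ℝ) / 2 ^ (k + 2)) = 1 :=
    hη.eq_one' (by rw [abs_div_two_pow, div_le_one (by positivity)]; exact h₂)
  rw [chiZ_succ η₀ (k + 1), chiZ_succ η₀ k, h1]
  cases k with
  | zero =>
    have hn : (2 : ℝ) ≤ |(n : ℝ)| := by
      have : (1 : ℤ) < |n| := by
        have h' : ((1 : ℤ) : ℝ) < ((|n| : ℤ) : ℝ) := by simpa using h₁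
        exact_mod_cast h'
      have h' : ((2 : ℤ) : ℝ) ≤ ((|n| : ℤ) : ℝ) := by exact_mod_cast this
      simpa using h'
    have h0 : η₀ ((n : ℝ) / 2 ^ 0) = 0 := hη.eq_zero (by simpa using hn)
    simp only [prevTerm]
    rw [h0]; ring
  | succ j =>
    have h0 : η₀ ((n : ℝ) / 2 ^ j) = 0 := hη.eq_zero (by
      rw [abs_div_two_pow, le_div_iff₀ (by positivity)]
      rw [pow_succ] at h₁; linarith)
    simp only [prevTerm]
    rw [chiZ_succ η₀ j, h0]; ring

lemma psiZ_sq_le {η₀ : ℝ → ℝ} (hη : BumpFun η₀) {M : ℝ}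
    (hM : ∀ x, |x * deriv η₀ x| ≤ M) (k : ℕ) (n : ℤ) :
    psiZ η₀ (k + 1) n ^ 2 ≤ 12 * M ^ 2 *
      (prevTerm (fun j => chiZ η₀ (j + 1) n ^ 2) k + chiZ η₀ (k + 1) n ^ 2 +
        chiZ η₀ (k + 2) n ^ 2) := by
  have hprev : prevTerm (fun j => chiZ η₀ (j + 1) n ^ 2) k =
      prevTerm (fun j => chiZ η₀ (j + 1) n) k ^ 2 := by cases k <;> simp [prevTerm]
  rw [hprev]
  by_cases h : (2 : ℝ) ^ k < |(n : ℝ)| ∧ |(n : ℝ)| ≤ 2 ^ (k + 2)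
  · have hsum := sum_chiZ_eq_one hη h.1 h.2
    set x := prevTerm (fun j => chiZ η₀ (j + 1) n) k
    set y := chiZ η₀ (k + 1) n
    set z := chiZ η₀ (k + 2) n
    have hxyz : 1 ≤ 3 * (x ^ 2 + y ^ 2 + z ^ 2) := by
      have : (x + y + z) ^ 2 = 1 := by rw [hsum]; norm_num
      nlinarith [sq_nonneg (x - y), sq_nonneg (x - z), sq_nonneg (y - z)]
    have hψ : |psiZ η₀ (k + 1) n| ≤ 2 * M := by
      rw [psiZ_succ hη]
      refine (abs_sub _ _).trans ?_
      linarith [hM ((n : ℝ) / 2 ^ (k + 1)), hM ((n : ℝ) / 2 ^ k)]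
    have h2 := sq_le_sq' (abs_le.1 hψ).1 (abs_le.1 hψ).2
    nlinarith [mul_le_mul_of_nonneg_left hxyz (sq_nonneg M)]
  · have hz : ∀ j ∈ ({k, k + 1} : Set ℕ), deriv η₀ ((n : ℝ) / 2 ^ j) = 0 := by
      intro j hj
      apply hη.deriv_eq_zero
      rw [abs_div_two_pow, div_le_one (by positivity), le_div_iff₀ (by positivity)]
      have hp : (0 : ℝ) < 2 ^ k := by positivity
      rw [not_and_or, not_lt, not_le, pow_add] at h
      rcases hj with rfl | rfl
      · rcases h with h | h
        · exact Or.inl h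
        · right; linarith
      · rw [pow_succ]
        rcases h with h | h
        · left; linarith
        · right; linarith
    rw [psiZ_succ hη, hz k (by simp), hz (k + 1) (by simp)]
    rw [mul_zero, mul_zero, sub_zero, zero_pow two_ne_zero]
    positivity

/-! ### The quadrilinear correction term -/

/-- The involution exchanging `n₃` with `n = -(n₁+n₂+n₃)`. -/
def swapLast : ℤ × ℤ × ℤ ≃ ℤ × ℤ × ℤ :=
  Function.Involutive.toPerm (fun p => (p.1, p.2.1, -(p.1 + p.2.1 + p.2.2)))
    fun p => by ext <;> dsimp only; ring

lemma swapLast_apply (p : ℤ × ℤ × ℤ) :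
    swapLast p = (p.1, p.2.1, -(p.1 + p.2.1 + p.2.2)) := rfl

lemma hasSum_mul_mul {α β γ : ℤ → ℝ} (hα : ∀ n, 0 ≤ α n) (hβ : ∀ n, 0 ≤ β n)
    (hγ : ∀ n, 0 ≤ γ n) (sα : Summable α) (sβ : Summable β) (sγ : Summable γ) :
    HasSum (fun p : ℤ × ℤ × ℤ => α p.1 * (β p.2.1 * γ p.2.2))
      ((∑' n, α n) * ((∑' n, β n) * ∑' n, γ n)) := by
  have s1 := sβ.mul_of_nonneg sγ hβ hγ
  have h1 := sβ.hasSum.mul sγ.hasSum s1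
  exact sα.hasSum.mul h1 (sα.mul_of_nonneg s1 hα fun x => mul_nonneg (hβ _) (hγ _))

/-- Young's inequality for the quadrilinear form over `n₁+n₂+n₃+n = 0`. -/
lemma abs_re_tsum_quad_le {α β f g : ℤ → ℝ} {F : ℤ × ℤ × ℤ → ℂ} (hα : ∀ n, 0 ≤ α n)
    (hβ : ∀ n, 0 ≤ β n) (sα : Summable α) (sβ : Summable β)
    (sf : Summable fun n => f n ^ 2) (sg : Summable fun n => g n ^ 2)
    (hF : ∀ p, ‖F p‖ ≤ α p.1 * (β p.2.1 * (f p.2.2 * g (-(p.1 + p.2.1 + p.2.2))))) :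
    |(∑' p, F p).re| ≤
      (∑' n, α n) * (∑' n, β n) * (∑' n, f n ^ 2 + ∑' n, g n ^ 2) / 2 := by
  have h1 := hasSum_mul_mul hα hβ (fun n => sq_nonneg (f n)) sα sβ sf
  have h2 := swapLast.hasSum_iff.2
    (hasSum_mul_mul hα hβ (fun n => sq_nonneg (g n)) sα sβ sg)
  have h3 := (h1.add h2).div_const 2
  refine (Complex.abs_re_le_norm _).trans ((tsum_of_norm_bounded h3 fun p => ?_).trans_eq
    (by ring))
  refine (hF p).trans ?_
  simp only [Function.comp, swapLast_apply]
  have := mul_le_mul_of_nonneg_left (two_mul_le_add_sq (f p.2.2) (g (-(p.1 + p.2.1 + p.2.2))))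
    (mul_nonneg (hα p.1) (hβ p.2.1))
  linarith

/-- The squared `L²` norm of the dyadic piece `P_k a`. -/
def dyadicMass (η₀ : ℝ → ℝ) (k : ℕ) (a : ℤ → ℂ) : ℝ := ∑' n : ℤ, (|chiZ η₀ k n| * ‖a n‖) ^ 2

lemma tsum_norm_sq_eq_dyadicMass (η₀ : ℝ → ℝ) (k : ℕ) (a : ℤ → ℂ) :
    ∑' n : ℤ, ‖((chiZ η₀ k n : ℝ) : ℂ) * a n‖ ^ 2 = dyadicMass η₀ k a := by
  simp [dyadicMass]

lemma dyadicMass_nonneg (η₀ : ℝ → ℝ) (k : ℕ) (a : ℤ → ℂ) : 0 ≤ dyadicMass η₀ k a :=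
  tsum_nonneg fun _ => sq_nonneg _

lemma InHs.summable_sq {s : ℝ} (hs : 0 ≤ s) {a : ℤ → ℂ} (ha : InHs s a) :
    Summable fun n => ‖a n‖ ^ 2 :=
  ha.of_nonneg_of_le (fun _ => sq_nonneg _) fun n =>
    le_mul_of_one_le_left (sq_nonneg _) (one_le_hsWeight hs n)

lemma chiZ_mul_norm_sq_le {η₀ : ℝ → ℝ} (hη : BumpFun η₀) (k : ℕ) (a : ℤ → ℂ) (n : ℤ) :
    (|chiZ η₀ (k + 1) n| * ‖a n‖) ^ 2 ≤ ‖a n‖ ^ 2 :=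
  pow_le_pow_left₀ (by positivity)
    (mul_le_of_le_one_left (norm_nonneg _) (abs_chiZ_succ_le hη k n)) 2

lemma summable_chiZ_sq {η₀ : ℝ → ℝ} (hη : BumpFun η₀) (k : ℕ) {a : ℤ → ℂ}
    (ha : Summable fun n => ‖a n‖ ^ 2) :
    Summable fun n => (|chiZ η₀ (k + 1) n| * ‖a n‖) ^ 2 :=
  ha.of_nonneg_of_le (fun _ => sq_nonneg _) fun n => chiZ_mul_norm_sq_le hη k a n

lemma norm_intCast_inv_le_one (n : ℤ) : ‖((n : ℂ))⁻¹‖ ≤ 1 := by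
  rcases eq_or_ne n 0 with rfl | hn
  · simp
  · rw [norm_inv]
    refine inv_le_one_of_one_le₀ ?_
    rw [Complex.norm_intCast]
    exact_mod_cast Int.one_le_abs hn

lemma abs_quadEnergyTerm_le {η₀ : ℝ → ℝ} (hη : BumpFun η₀) (k : ℕ) (g : ℤ → ℝ)
    {a b w : ℤ → ℂ} (ha : Summable fun n => ‖a n‖) (hb : Summable fun n => ‖b n‖)
    (hw : Summable fun n => ‖w n‖ ^ 2) (hg : Summable fun n => (|g n| * ‖w n‖) ^ 2) :
    |quadEnergyTerm η₀ (k + 1) g a b w| ≤ (∑' n, ‖a n‖) * (∑' n, ‖b n‖) *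
      (∑' n, (|g n| * ‖w n‖) ^ 2 + dyadicMass η₀ (k + 1) w) / 2 := by
  refine abs_re_tsum_quad_le (fun n => norm_nonneg _) (fun n => norm_nonneg _) ha hb hg
    (summable_chiZ_sq hη k hw) fun p => ?_
  split_ifs
  · simp only [norm_mul, Complex.norm_real, Real.norm_eq_abs]
    set m := -(p.1 + p.2.1 + p.2.2)
    have h1 := norm_intCast_inv_le_one p.2.2
    have h2 := norm_intCast_inv_le_one m
    calc _ = ‖a p.1‖ * (‖b p.2.1‖ * (|g p.2.2| * ‖w p.2.2‖ * (|chiZ η₀ (k + 1) m| * ‖w m‖))) *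
          (‖((p.2.2 : ℤ) : ℂ)⁻¹‖ * ‖((m : ℤ) : ℂ)⁻¹‖) := by ring
      _ ≤ _ := mul_le_of_le_one_right (by positivity)
          (mul_le_one₀ h1 (norm_nonneg _) h2)
  · rw [norm_zero]; positivity

lemma summable_psiZ_sq_and_tsum_le {η₀ : ℝ → ℝ} (hη : BumpFun η₀) {M : ℝ}
    (hM : ∀ x, |x * deriv η₀ x| ≤ M) (k : ℕ) {w : ℤ → ℂ} (hw : Summable fun n => ‖w n‖ ^ 2) :
    Summable (fun n => (|psiZ η₀ (k + 1) n| * ‖w n‖) ^ 2) ∧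
      ∑' n, (|psiZ η₀ (k + 1) n| * ‖w n‖) ^ 2 ≤ 12 * M ^ 2 *
        (prevTerm (fun j => dyadicMass η₀ (j + 1) w) k + dyadicMass η₀ (k + 1) w +
          dyadicMass η₀ (k + 2) w) := by
  have hprev : HasSum (fun n : ℤ => prevTerm (fun j => chiZ η₀ (j + 1) n ^ 2) k * ‖w n‖ ^ 2)
      (prevTerm (fun j => dyadicMass η₀ (j + 1) w) k) := by
    cases k with
    | zero => simp [prevTerm, hasSum_zero]
    | succ k => simpa [prevTerm, mul_pow, dyadicMass] using (summable_chiZ_sq hη k hw).hasSum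
  have hmass : ∀ j, HasSum (fun n => chiZ η₀ (j + 1) n ^ 2 * ‖w n‖ ^ 2)
      (dyadicMass η₀ (j + 1) w) := fun j => by
    simpa [mul_pow, dyadicMass] using (summable_chiZ_sq hη j hw).hasSum
  have h := ((hprev.add (hmass k)).add (hmass (k + 1))).mul_left (12 * M ^ 2)
  have hle : ∀ n, (|psiZ η₀ (k + 1) n| * ‖w n‖) ^ 2 ≤ 12 * M ^ 2 *
      (prevTerm (fun j => chiZ η₀ (j + 1) n ^ 2) k * ‖w n‖ ^ 2 +
        chiZ η₀ (k + 1) n ^ 2 * ‖w n‖ ^ 2 + chiZ η₀ (k + 1 + 1) n ^ 2 * ‖w n‖ ^ 2) := fun n => by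
    have := mul_le_mul_of_nonneg_right (psiZ_sq_le hη hM k n) (sq_nonneg ‖w n‖)
    rw [mul_pow, sq_abs]
    linarith
  have hs := h.summable.of_nonneg_of_le (fun n => sq_nonneg _) hle
  exact ⟨hs, (hs.tsum_le_tsum hle h.summable).trans_eq h.tsum_eq⟩

lemma prevTerm_nonneg {u : ℕ → ℝ} (hu : ∀ k, 0 ≤ u k) (k : ℕ) : 0 ≤ prevTerm u k := by
  cases k
  exacts [le_rfl, hu _]

/-- The correction terms are small compared with the neighbouring dyadic masses. -/
lemma abs_modEnergyK_sub_le {η₀ : ℝ → ℝ} (hη : BumpFun η₀) {M : ℝ}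
    (hM : ∀ x, |x * deriv η₀ x| ≤ M) {v₁ v₂ w : ℝ → ℤ → ℂ} {t L : ℝ}
    (hs₁ : Summable fun n => ‖v₁ t n‖) (hs₂ : Summable fun n => ‖v₂ t n‖)
    (hL₁ : ∑' n, ‖v₁ t n‖ ≤ L) (hL₂ : ∑' n, ‖v₂ t n‖ ≤ L)
    (hw : Summable fun n => ‖w t n‖ ^ 2) (k : ℕ) :
    |modEnergyK η₀ (k + 1) v₁ v₂ w t - dyadicMass η₀ (k + 1) (w t)| ≤
      (24 * M ^ 2 + 4) * L ^ 2 *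
        (prevTerm (fun j => dyadicMass η₀ (j + 1) (w t)) k + dyadicMass η₀ (k + 1) (w t) +
          dyadicMass η₀ (k + 2) (w t)) := by
  obtain ⟨hψ, hψ'⟩ := summable_psiZ_sq_and_tsum_le hη hM k hw
  have hχ := summable_chiZ_sq hη k hw
  have hp := prevTerm_nonneg (fun j => dyadicMass_nonneg η₀ (j + 1) (w t)) k
  have hc := dyadicMass_nonneg η₀ (k + 1) (w t)
  have hn := dyadicMass_nonneg η₀ (k + 2) (w t)
  set p := prevTerm (fun j => dyadicMass η₀ (j + 1) (w t)) k
  set c := dyadicMass η₀ (k + 1) (w t) with hcdef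
  set q := dyadicMass η₀ (k + 2) (w t)
  have hL : 0 ≤ L := (tsum_nonneg fun n => norm_nonneg _).trans hL₁
  have hD : 0 ≤ p + c + q := by positivity
  have bound : ∀ a b : ℤ → ℂ, Summable (fun n => ‖a n‖) → Summable (fun n => ‖b n‖) →
      ∑' n, ‖a n‖ ≤ L → ∑' n, ‖b n‖ ≤ L →
      |quadEnergyTerm η₀ (k + 1) (psiZ η₀ (k + 1)) a b (w t)| ≤
        L ^ 2 * ((6 * M ^ 2 + 1 / 2) * (p + c + q)) ∧
      |quadEnergyTerm η₀ (k + 1) (chiZ η₀ (k + 1)) a b (w t)| ≤ L ^ 2 * (p + c + q) := by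
    intro a b ha hb hLa hLb
    have hab : (∑' n, ‖a n‖) * (∑' n, ‖b n‖) ≤ L ^ 2 := by
      rw [sq]
      exact mul_le_mul hLa hLb (tsum_nonneg fun n => norm_nonneg _) hL
    constructor
    · refine (abs_quadEnergyTerm_le hη k _ ha hb hw hψ).trans ?_
      rw [mul_div_assoc]
      refine mul_le_mul hab ?_ ?_ (sq_nonneg L)
      · linarith
      · exact div_nonneg (add_nonneg (tsum_nonneg fun n => sq_nonneg _) hc) two_pos.le
    · refine (abs_quadEnergyTerm_le hη k _ ha hb hw hχ).trans ?_
      rw [mul_div_assoc]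
      change _ * ((c + c) / 2) ≤ _
      refine mul_le_mul hab ?_ (by linarith) (sq_nonneg L)
      linarith
  have b11 := bound _ _ hs₁ hs₁ hL₁ hL₁
  have b12 := bound _ _ hs₁ hs₂ hL₁ hL₂
  have b22 := bound _ _ hs₂ hs₂ hL₂ hL₂
  simp only [abs_le] at b11 b12 b22
  rw [modEnergyK, tsum_norm_sq_eq_dyadicMass, ← hcdef, abs_le]
  constructor <;>
    linarith [b11.1.1, b11.1.2, b11.2.1, b11.2.2, b12.1.1, b12.1.2, b12.2.1, b12.2.2,
      b22.1.1, b22.1.2, b22.2.1, b22.2.2]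

/-! ### Summation over dyadic blocks -/

lemma abs_sSup_image_sub_sSup_image_le {f g : ℝ → ℝ} {S : Set ℝ} (hS : S.Nonempty) {B : ℝ}
    (hg : BddAbove (g '' S)) (h : ∀ t ∈ S, |f t - g t| ≤ B) :
    |sSup (f '' S) - sSup (g '' S)| ≤ B := by
  have hf : ∀ t ∈ S, f t ≤ sSup (g '' S) + B := fun t ht => by
    have h1 := (abs_le.1 (h t ht)).2
    have h2 := le_csSup hg (mem_image_of_mem g ht)
    linarith
  have hfb : BddAbove (f '' S) := ⟨_, by rintro _ ⟨t, ht, rfl⟩; exact hf t ht⟩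
  rw [abs_le]
  constructor
  · suffices sSup (g '' S) ≤ sSup (f '' S) + B by linarith
    refine csSup_le (hS.image g) ?_
    rintro _ ⟨t, ht, rfl⟩
    have h1 := (abs_le.1 (h t ht)).1
    have h2 := le_csSup hfb (mem_image_of_mem f ht)
    linarith
  · suffices sSup (f '' S) ≤ sSup (g '' S) + B by linarith
    refine csSup_le (hS.image f) ?_
    rintro _ ⟨t, ht, rfl⟩
    exact hf t ht

/-- Comparison of geometrically weighted sums of two sequences which agree up to a small multiple
of the neighbouring terms. -/
lemma abs_tsum_weighted_sub_le {W S E : ℕ → ℝ} {r ε : ℝ} (hr : 1 ≤ r) (hW : ∀ k, 0 < W k)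
    (hWr : ∀ k, W (k + 1) = r * W k) (hS : ∀ k, 0 ≤ S k) (hsum : Summable fun k => W k * S k)
    (hε : 0 ≤ ε) (h : ∀ k, |E k - S k| ≤ ε * (prevTerm S k + S k + S (k + 1))) :
    |∑' k, W k * E k - ∑' k, W k * S k| ≤ ε * (r + 2) * ∑' k, W k * S k := by
  have hWS : ∀ k, 0 ≤ W k * S k := fun k => mul_nonneg (hW k).le (hS k)
  have sprev : HasSum (fun k => W k * prevTerm S k) (r * ∑' k, W k * S k) := by
    refine (hasSum_nat_add_iff' 1).1 ?_
    simp only [prevTerm, hWr, mul_assoc, Finset.sum_range_one, mul_zero, sub_zero]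
    exact hsum.hasSum.mul_left r
  have hshift : Summable fun k => W (k + 1) * S (k + 1) := (summable_nat_add_iff 1).2 hsum
  have hshift' : ∑' k, W (k + 1) * S (k + 1) ≤ ∑' k, W k * S k := by
    rw [hsum.tsum_eq_zero_add]
    linarith [hWS 0]
  have hb := ((sprev.add hsum.hasSum).add hshift.hasSum).mul_left ε
  have hle : ∀ k, ‖W k * E k - W k * S k‖ ≤
      ε * (W k * prevTerm S k + W k * S k + W (k + 1) * S (k + 1)) := fun k => by
    have h1 := mul_le_mul_of_nonneg_left (h k) (hW k).le
    have h2 : W k * S (k + 1) ≤ W (k + 1) * S (k + 1) := by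
      refine mul_le_mul_of_nonneg_right ?_ (hS _)
      rw [hWr]
      exact le_mul_of_one_le_left (hW k).le hr
    rw [← mul_sub, Real.norm_eq_abs, abs_mul, abs_of_pos (hW k)]
    linarith [mul_le_mul_of_nonneg_left h2 hε]
  have sdiff : Summable fun k => W k * E k - W k * S k := .of_norm_bounded hb.summable hle
  have sE : Summable fun k => W k * E k := by simpa using sdiff.add hsum
  rw [← sE.tsum_sub hsum, ← Real.norm_eq_abs]
  refine (tsum_of_norm_bounded hb hle).trans ?_
  have := mul_le_mul_of_nonneg_left hshift' hε
  linarith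

/-- Decay of the dyadic masses of a smooth function. -/
lemma weight_mul_dyadicMass_le {η₀ : ℝ → ℝ} (hη : BumpFun η₀) {s : ℝ} (hs : 0 ≤ s) (k : ℕ)
    {a : ℤ → ℂ} (ha : InHs (s + 1) a) :
    (2 : ℝ) ^ (2 * s * ((k : ℝ) + 1)) * dyadicMass η₀ (k + 1) a ≤
      (2 : ℝ) ^ (2 * s) * (1 / 4) ^ k * hsNormSq (s + 1) a := by
  have hsum := summable_chiZ_sq hη k (ha.summable_sq (by linarith))
  rw [dyadicMass, hsNormSq, ← tsum_mul_left, ← tsum_mul_left]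
  refine (hsum.mul_left _).tsum_le_tsum (fun n => ?_) (ha.mul_left _)
  by_cases hn : |(n : ℝ)| ≤ 2 ^ k
  · rw [chiZ_succ_eq_zero hη hn]
    simp only [abs_zero, zero_mul, ne_eq, OfNat.ofNat_ne_zero, not_false_eq_true, zero_pow,
      mul_zero]
    exact mul_nonneg (by positivity) (mul_nonneg (hsWeight_pos _ n).le (sq_nonneg _))
  · have hweight : (2 : ℝ) ^ (2 * s * ((k : ℝ) + 1)) ≤
        (2 : ℝ) ^ (2 * s) * (1 / 4) ^ k * hsWeight (s + 1) n := by
      have h4 : ((4 : ℝ) ^ k) ^ (s + 1) ≤ hsWeight (s + 1) n := by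
        refine Real.rpow_le_rpow (by positivity) ?_ (by linarith)
        rw [not_le] at hn
        have := pow_le_pow_left₀ (by positivity) hn.le 2
        rw [sq_abs, ← pow_mul, mul_comm, pow_mul] at this
        norm_num at this
        linarith
      have e : (2 : ℝ) ^ (2 * s * ((k : ℝ) + 1)) =
          (2 : ℝ) ^ (2 * s) * (1 / 4) ^ k * ((4 : ℝ) ^ k) ^ (s + 1) := by
        have e4 : (4 : ℝ) ^ k = (2 : ℝ) ^ (2 * (k : ℝ)) := by
          rw [Real.rpow_mul two_pos.le, Real.rpow_natCast]; norm_num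
        rw [one_div, inv_pow, e4, ← Real.rpow_neg two_pos.le, ← Real.rpow_mul two_pos.le,
          ← Real.rpow_add two_pos, ← Real.rpow_add two_pos]
        congr 1; ring
      rw [e]
      exact mul_le_mul_of_nonneg_left h4 (by positivity)
    calc _ ≤ (2 : ℝ) ^ (2 * s * ((k : ℝ) + 1)) * ‖a n‖ ^ 2 :=
          mul_le_mul_of_nonneg_left (chiZ_mul_norm_sq_le hη k a n) (by positivity)
      _ ≤ (2 : ℝ) ^ (2 * s) * (1 / 4) ^ k * hsWeight (s + 1) n * ‖a n‖ ^ 2 :=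
          mul_le_mul_of_nonneg_right hweight (sq_nonneg _)
      _ = _ := by ring

/-- The modified energy is comparable with the energy norm, with a smallness threshold depending
only on the cutoff and on `s`. -/
theorem exists_threshold_modEnergyT_comparable {η₀ : ℝ → ℝ} (hη : BumpFun η₀) {s : ℝ}
    (hs : 1 / 2 < s) :
    ∃ δ > (0 : ℝ), ∀ T > 0, ∀ v₁ v₂ : ℝ → ℤ → ℂ, ContHs s T v₁ → ContHs s T v₂ →
      ContHs (s + 1) T v₁ → ContHs (s + 1) T v₂ →
      ∀ w : ℝ → ℤ → ℂ, (∀ t n, w t n = v₁ t n - v₂ t n) →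
        (∀ t ∈ Icc (-T) T, hsNorm s (v₁ t) ≤ δ) →
        (∀ t ∈ Icc (-T) T, hsNorm s (v₂ t) ≤ δ) →
        1 / 2 * EsTNormSq η₀ s T w ≤ modEnergyT η₀ s T v₁ v₂ w ∧
          modEnergyT η₀ s T v₁ v₂ w ≤ 3 / 2 * EsTNormSq η₀ s T w := by
  obtain ⟨M, -, hM⟩ := hη.exists_abs_mul_deriv_le
  set K := Real.sqrt (∑' n : ℤ, (hsWeight s n)⁻¹)
  set r := (2 : ℝ) ^ (2 * s)
  have hr : 1 ≤ r := Real.one_le_rpow one_le_two (by linarith)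
  set Q := (24 * M ^ 2 + 4) * K ^ 2 * (r + 2)
  have hQ : 0 ≤ Q := by positivity
  have hδ : 0 < (1 : ℝ) / (2 * (Q + 1)) := by positivity
  refine ⟨Real.sqrt (1 / (2 * (Q + 1))), Real.sqrt_pos.2 hδ, ?_⟩
  set δ := Real.sqrt (1 / (2 * (Q + 1)))
  have hδ2 : δ ^ 2 = 1 / (2 * (Q + 1)) := Real.sq_sqrt hδ.le
  intro T hT v₁ v₂ h₁ h₂ h₁' h₂' w hw hb₁ hb₂
  obtain ⟨R₁, hR₁⟩ := h₁'.exists_bound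
  obtain ⟨R₂, hR₂⟩ := h₂'.exists_bound
  have hw' : ∀ t, w t = fun n => v₁ t n - v₂ t n := fun t => funext (hw t)
  have hwH : ∀ t ∈ Icc (-T) T, InHs (s + 1) (w t) := fun t ht => by
    rw [hw']; exact (h₁'.1 t ht).sub (h₂'.1 t ht)
  have hwR : ∀ t ∈ Icc (-T) T, hsNormSq (s + 1) (w t) ≤ 2 * R₁ + 2 * R₂ := fun t ht => by
    rw [hw']
    linarith [hsNormSq_sub_le (h₁'.1 t ht) (h₂'.1 t ht), hR₁ t ht, hR₂ t ht]
  have h0 : (0 : ℝ) ∈ Icc (-T) T := ⟨by linarith, hT.le⟩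
  have hne : (Icc (-T) T).Nonempty := ⟨0, h0⟩
  set W : ℕ → ℝ := fun k => (2 : ℝ) ^ (2 * s * ((k : ℝ) + 1)) with hWdef
  have hW : ∀ k, 0 < W k := fun k => by positivity
  set A : ℕ → ℝ → ℝ := fun k t => dyadicMass η₀ (k + 1) (w t)
  set S : ℕ → ℝ := fun k => sSup (A k '' Icc (-T) T)
  have hWA : ∀ k, ∀ t ∈ Icc (-T) T, A k t ≤ (W k)⁻¹ * (r * (1 / 4) ^ k * (2 * R₁ + 2 * R₂)) :=
    fun k t ht => by
      rw [← div_eq_inv_mul, le_div_iff₀ (hW k), mul_comm]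
      exact (weight_mul_dyadicMass_le hη (by linarith) k (hwH t ht)).trans
        (mul_le_mul_of_nonneg_left (hwR t ht) (by positivity))
  have hbdd : ∀ k, BddAbove (A k '' Icc (-T) T) := fun k =>
    ⟨_, by rintro _ ⟨t, ht, rfl⟩; exact hWA k t ht⟩
  have hAS : ∀ k, ∀ t ∈ Icc (-T) T, A k t ≤ S k := fun k t ht =>
    le_csSup (hbdd k) (mem_image_of_mem _ ht)
  have hS : ∀ k, 0 ≤ S k := fun k => (dyadicMass_nonneg _ _ _).trans (hAS k 0 h0)
  have hsum : Summable fun k => W k * S k := by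
    have hgeo : Summable fun k : ℕ => r * (1 / 4 : ℝ) ^ k * (2 * R₁ + 2 * R₂) :=
      ((summable_geometric_of_lt_one (by norm_num) (by norm_num)).mul_left r).mul_right _
    refine hgeo.of_nonneg_of_le (fun k => mul_nonneg (hW k).le (hS k)) fun k => ?_
    have : S k ≤ (W k)⁻¹ * (r * (1 / 4) ^ k * (2 * R₁ + 2 * R₂)) :=
      csSup_le (hne.image _) (by rintro _ ⟨t, ht, rfl⟩; exact hWA k t ht)
    rwa [← div_eq_inv_mul, le_div_iff₀ (hW k), mul_comm] at this
  have hWr : ∀ k, W (k + 1) = r * W k := fun k => by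
    simp only [hWdef, r]
    rw [← Real.rpow_add two_pos]
    congr 1; push_cast; ring
  have herr : ∀ k, |sSup (modEnergyK η₀ (k + 1) v₁ v₂ w '' Icc (-T) T) - S k| ≤
      (24 * M ^ 2 + 4) * (K * δ) ^ 2 * (prevTerm S k + S k + S (k + 1)) := fun k => by
    refine abs_sSup_image_sub_sSup_image_le hne (hbdd k) fun t ht => ?_
    obtain ⟨s₁, l₁⟩ := (h₁.1 t ht).summable_norm hs
    obtain ⟨s₂, l₂⟩ := (h₂.1 t ht).summable_norm hs
    refine (abs_modEnergyK_sub_le hη hM s₁ s₂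
      (l₁.trans (mul_le_mul_of_nonneg_left (hb₁ t ht) (Real.sqrt_nonneg _)))
      (l₂.trans (mul_le_mul_of_nonneg_left (hb₂ t ht) (Real.sqrt_nonneg _)))
      ((hwH t ht).summable_sq (by linarith)) k).trans
      (mul_le_mul_of_nonneg_left ?_ (by positivity))
    refine add_le_add (add_le_add ?_ (hAS k t ht)) (hAS (k + 1) t ht)
    cases k with
    | zero => exact le_rfl
    | succ k => exact hAS k t ht
  have hmain := abs_tsum_weighted_sub_le hr hW hWr hS hsum (by positivity) herr
  have hWS0 : 0 ≤ ∑' k, W k * S k := tsum_nonneg fun k => mul_nonneg (hW k).le (hS k)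
  have hsmall : (24 * M ^ 2 + 4) * (K * δ) ^ 2 * (r + 2) ≤ 1 / 2 := by
    have e : (24 * M ^ 2 + 4) * (K * δ) ^ 2 * (r + 2) = Q * δ ^ 2 := by simp only [Q]; ring
    rw [e, hδ2, mul_one_div, div_le_div_iff₀ (by positivity) two_pos]
    linarith
  have hhalf := hmain.trans (mul_le_mul_of_nonneg_right hsmall hWS0)
  have hE : EsTNormSq η₀ s T w = dyadicMass η₀ 0 (w 0) + ∑' k, W k * S k := by
    rw [EsTNormSq, tsum_norm_sq_eq_dyadicMass]
    congr 1
    refine tsum_congr fun k => ?_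
    simp only [tsum_norm_sq_eq_dyadicMass]
    have := Real.sSup_smul_of_nonneg (hW k).le (A k '' Icc (-T) T)
    rw [← Set.image_smul, Set.image_image] at this
    simpa only [smul_eq_mul] using this
  have hE' : modEnergyT η₀ s T v₁ v₂ w = dyadicMass η₀ 0 (w 0) +
      ∑' k, W k * sSup (modEnergyK η₀ (k + 1) v₁ v₂ w '' Icc (-T) T) := by
    rw [modEnergyT, tsum_norm_sq_eq_dyadicMass]
  have hP := dyadicMass_nonneg η₀ 0 (w 0)
  rw [hE, hE']
  rw [abs_le] at hhalf
  constructor <;> linarith [hhalf.1, hhalf.2]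

/-- **Comparability of the modified energy and the `E^s(T)` norm** (Lemma 3.5). -/
theorem modified_energy_comparable (η₀ : ℝ → ℝ) (hη : BumpFun η₀) (d₁ d₂ : ℝ)
    (s : ℝ) (hs : 1 / 2 < s) :
    ∀ T ∈ Ioc (0:ℝ) 1, ∀ v₁ v₂ : ℝ → ℤ → ℂ,
      IsSymSolution d₁ d₂ T v₁ → IsSymSolution d₁ d₂ T v₂ →
      ContHinf T v₁ → ContHinf T v₂ →
      ∀ w : ℝ → ℤ → ℂ, (∀ t n, w t n = v₁ t n - v₂ t n) →
      ∃ δ > (0:ℝ),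
        (∀ t ∈ Icc (-T) T, hsNorm s (v₁ t) ≤ δ) →
        (∀ t ∈ Icc (-T) T, hsNorm s (v₂ t) ≤ δ) →
        1 / 2 * EsTNormSq η₀ s T w ≤ modEnergyT η₀ s T v₁ v₂ w ∧
          modEnergyT η₀ s T v₁ v₂ w ≤ 3 / 2 * EsTNormSq η₀ s T w := by
  intro T hT v₁ v₂ _ _ h₁ h₂ w hw
  obtain ⟨δ, hδ, h⟩ := exists_threshold_modEnergyT_comparable hη hs
  exact ⟨δ, hδ, h T hT.1 v₁ v₂ (h₁ s) (h₂ s) (h₁ (s + 1)) (h₂ (s + 1)) w hw⟩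

end MKdV5
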